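/- Let Π be a closed and strictly positive set of distributions on {0,1}^p, let r be a quota rule and f a logical connection. There exists a constant c > 0, depending only on Π, q, d, and f, such that for every n ≥ 1 for which both condition κ1(n) and condition κ2(n) fail, DP^max(n) ≥ c·n^{−1/2}. -/

import Mathlib

/-- A judgement on `p` premises: a vector in `{0,1}^p`, encoded as `Fin p → Bool`. -/
abbrev Judg (p : ℕ) : Type := Fin p → Bool

noncomputable section

/-- `Ω_i`: for a premise index `i < p`, the set of judgements whose `i`-th premise is `1`;
for the conclusion index `i = p`, the set of judgements `ω` with `f ω = 1`. -/
def Omega (p : ℕ) (f : Judg p → Bool) (i : Fin (p + 1)) : Finset (Judg p) :=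
  if h : (i : ℕ) < p then Finset.univ.filter (fun ω => ω ⟨(i : ℕ), h⟩ = true)
  else Finset.univ.filter (fun ω => f ω = true)

/-- The vector `c_i ∈ ℝ^({0,1}^p)`: `c_i(ω) = q_i - 1` if `ω ∈ Ω_i`, else `q_i`. -/
def cvec (p : ℕ) (f : Judg p → Bool) (q : Fin (p + 1) → ℝ) (i : Fin (p + 1)) :
    Judg p → ℝ :=
  fun ω => if ω ∈ Omega p f i then q i - 1 else q i

/-- Euclidean inner product on `ℝ^({0,1}^p)`. -/
def inn (p : ℕ) (u v : Judg p → ℝ) : ℝ := ∑ ω : Judg p, u ω * v ω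

/-- The histogram of a profile: how many agents cast each judgement. -/
def Hist (p n : ℕ) (P : Fin n → Judg p) (ω : Judg p) : ℕ :=
  (Finset.univ.filter (fun j => P j = ω)).card

/-- The histogram, viewed as a vector in `ℝ^({0,1}^p)`. -/
def HistR (p n : ℕ) (P : Fin n → Judg p) : Judg p → ℝ :=
  fun ω => (Hist p n P ω : ℝ)

/-- `n_i(P)`: the number of agents of `P` whose judgement lies in `Ω_i`. -/
def nOnes (p n : ℕ) (f : Judg p → Bool) (P : Fin n → Judg p) (i : Fin (p + 1)) : ℕ :=
  ∑ ω ∈ Omega p f i, Hist p n P ω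

/-- The quota rule on profiles, with thresholds `q` and tie-breakings `d`. -/
def quota (p n : ℕ) (f : Judg p → Bool) (q : Fin (p + 1) → ℝ) (d : Fin (p + 1) → Bool)
    (P : Fin n → Judg p) (i : Fin (p + 1)) : Bool := by
  classical
  exact if (nOnes p n f P i : ℝ) > q i * (n : ℝ) then true
    else if (nOnes p n f P i : ℝ) = q i * (n : ℝ) then d i
    else false

/-- The real value of a bit: `1` for `1`/true, `0` for `0`/false. -/
def bval (b : Bool) : ℝ := if b then 1 else 0

/-- `sign(1) = 1` and `sign(0) = -1`. -/
def sgn (b : Bool) : ℝ := if b then 1 else -1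

/-- `α ∈ {0,1}^{p+1}` is consistent if its conclusion component equals `f` applied to
its premise components. -/
def Consistent (p : ℕ) (f : Judg p → Bool) (α : Fin (p + 1) → Bool) : Prop :=
  α (Fin.last p) = f (fun j => α j.castSucc)

/-- A profile is a doctrinal paradox if the quota-rule output is inconsistent. -/
def Paradox (p n : ℕ) (f : Judg p → Bool) (q : Fin (p + 1) → ℝ) (d : Fin (p + 1) → Bool)
    (P : Fin n → Judg p) : Prop :=
  ¬ Consistent p f (quota p n f q d P)

/-- The polyhedron `H_α`. -/
def polyH (p : ℕ) (f : Judg p → Bool) (q : Fin (p + 1) → ℝ) (d : Fin (p + 1) → Bool)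
    (α : Fin (p + 1) → Bool) : Set (Judg p → ℝ) :=
  {x | ∀ i : Fin (p + 1),
    sgn (α i) * inn p (cvec p f q i) x ≤ sgn (α i) * bval (d i) - bval (α i)}

/-- The characteristic cone `H_{α,≤0}`. -/
def coneH (p : ℕ) (f : Judg p → Bool) (q : Fin (p + 1) → ℝ)
    (α : Fin (p + 1) → Bool) : Set (Judg p → ℝ) :=
  {x | ∀ i : Fin (p + 1), sgn (α i) * inn p (cvec p f q i) x ≤ 0}

/-- A probability distribution on `{0,1}^p`. -/
def IsDistribution (p : ℕ) (π : Judg p → ℝ) : Prop :=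
  (∀ ω, 0 ≤ π ω) ∧ ∑ ω : Judg p, π ω = 1

/-- `pr_i(π) = Σ_{ω ∈ Ω_i} π(ω)`. -/
def pr (p : ℕ) (f : Judg p → Bool) (π : Judg p → ℝ) (i : Fin (p + 1)) : ℝ :=
  ∑ ω ∈ Omega p f i, π ω

/-- The quota rule applied to a distribution. -/
def quotaDist (p : ℕ) (f : Judg p → Bool) (q : Fin (p + 1) → ℝ) (d : Fin (p + 1) → Bool)
    (π : Judg p → ℝ) (i : Fin (p + 1)) : Bool := by
  classical
  exact if pr p f π i > q i then true
    else if pr p f π i = q i then d i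
    else false

/-- `α` is a refinement of `π`: it matches `r(π)` on every non-tied proposition. -/
def Refines (p : ℕ) (f : Judg p → Bool) (q : Fin (p + 1) → ℝ) (d : Fin (p + 1) → Bool)
    (π : Judg p → ℝ) (α : Fin (p + 1) → Bool) : Prop :=
  ∀ i : Fin (p + 1), pr p f π i ≠ q i → α i = quotaDist p f q d π i

/-- `α` is an effective refinement of `π` at `n`: a refinement realized by some profile. -/
def EffRef (p n : ℕ) (f : Judg p → Bool) (q : Fin (p + 1) → ℝ) (d : Fin (p + 1) → Bool)
    (π : Judg p → ℝ) (α : Fin (p + 1) → Bool) : Prop :=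
  Refines p f q d π α ∧ ∃ P : Fin n → Judg p, quota p n f q d P = α

/-- The probability that a random profile drawn from the independent (non-identical)
product of `vπ` is a doctrinal paradox. -/
def probParadox (p n : ℕ) (f : Judg p → Bool) (q : Fin (p + 1) → ℝ)
    (d : Fin (p + 1) → Bool) (vπ : Fin n → Judg p → ℝ) : ℝ := by
  classical
  exact ∑ P : Fin n → Judg p,
    if Paradox p n f q d P then ∏ j : Fin n, vπ j (P j) else 0

/-- The max-smoothed likelihood of the doctrinal paradox. -/
def DPmax (p n : ℕ) (f : Judg p → Bool) (q : Fin (p + 1) → ℝ) (d : Fin (p + 1) → Bool)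
    (D : Set (Judg p → ℝ)) : ℝ :=
  sSup {x : ℝ | ∃ vπ : Fin n → Judg p → ℝ,
    (∀ j, vπ j ∈ D) ∧ x = probParadox p n f q d vπ}

/-- The min-smoothed likelihood of the doctrinal paradox. -/
def DPmin (p n : ℕ) (f : Judg p → Bool) (q : Fin (p + 1) → ℝ) (d : Fin (p + 1) → Bool)
    (D : Set (Judg p → ℝ)) : ℝ :=
  sInf {x : ℝ | ∃ vπ : Fin n → Judg p → ℝ,
    (∀ j, vπ j ∈ D) ∧ x = probParadox p n f q d vπ}

/-- Condition `κ1(n)`: no profile of `n` agents is a doctrinal paradox. -/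
def kappa1 (p n : ℕ) (f : Judg p → Bool) (q : Fin (p + 1) → ℝ)
    (d : Fin (p + 1) → Bool) : Prop :=
  ∀ P : Fin n → Judg p, ¬ Paradox p n f q d P

/-- Condition `κ2(n)`: every effective refinement at `n` of every `π` in the convex hull
of `D` is consistent. -/
def kappa2 (p n : ℕ) (f : Judg p → Bool) (q : Fin (p + 1) → ℝ) (d : Fin (p + 1) → Bool)
    (D : Set (Judg p → ℝ)) : Prop :=
  ∀ π ∈ convexHull ℝ D, ∀ α : Fin (p + 1) → Bool,
    EffRef p n f q d π α → Consistent p f α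

/-- Condition `κ3(n)`: some `π` in the convex hull of `D` has all its effective
refinements at `n` consistent. -/
def kappa3 (p n : ℕ) (f : Judg p → Bool) (q : Fin (p + 1) → ℝ) (d : Fin (p + 1) → Bool)
    (D : Set (Judg p → ℝ)) : Prop :=
  ∃ π ∈ convexHull ℝ D, ∀ α : Fin (p + 1) → Bool,
    EffRef p n f q d π α → Consistent p f α

/-- Condition `κ4`: the conclusion depends on exactly one premise, with matching
thresholds. -/
def kappa4 (p : ℕ) (f : Judg p → Bool) (q : Fin (p + 1) → ℝ) : Prop :=
  ∃ i : Fin p,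
    ((∀ ω : Judg p, f ω = ω i) ∧ q (Fin.last p) = q i.castSucc) ∨
    ((∀ ω : Judg p, f ω = !(ω i)) ∧ q (Fin.last p) = 1 - q i.castSucc)

/-- `D` is strictly positive: some `ε > 0` lower-bounds every probability. -/
def StrictlyPositive (p : ℕ) (D : Set (Judg p → ℝ)) : Prop :=
  ∃ ε > (0 : ℝ), ∀ π ∈ D, ∀ ω : Judg p, ε ≤ π ω

section ProductProbability

variable {ι Ω : Type*} [Fintype ι] [DecidableEq ι] [Fintype Ω]

/-- The probability of the event `A` under the product of the weights `μ j`. -/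
def prodProb (μ : ι → Ω → ℝ) (A : Set (ι → Ω)) : ℝ :=
  ∑ P : ι → Ω, A.indicator (fun P => ∏ j, μ j (P j)) P

/-- The number of coordinates of `P` lying in `S`. -/
def countIn [DecidableEq Ω] (S : Finset Ω) (P : ι → Ω) : ℕ :=
  (Finset.univ.filter (fun j => P j ∈ S)).card

lemma sum_prod_eq_one {μ : ι → Ω → ℝ} (h1 : ∀ j, ∑ ω, μ j ω = 1) :
    ∑ P : ι → Ω, ∏ j, μ j (P j) = 1 := by
  rw [← Fintype.prod_sum]
  simp [h1]

lemma prodProb_nonneg {μ : ι → Ω → ℝ} (h0 : ∀ j ω, 0 ≤ μ j ω) (A : Set (ι → Ω)) :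
    0 ≤ prodProb μ A :=
  Finset.sum_nonneg fun _ _ =>
    Set.indicator_nonneg (fun P _ => Finset.prod_nonneg fun j _ => h0 j (P j)) _

lemma prodProb_mono {μ : ι → Ω → ℝ} (h0 : ∀ j ω, 0 ≤ μ j ω) {A B : Set (ι → Ω)}
    (hAB : A ⊆ B) : prodProb μ A ≤ prodProb μ B :=
  Finset.sum_le_sum fun P _ =>
    Set.indicator_le_indicator_of_subset hAB
      (fun P => Finset.prod_nonneg fun j _ => h0 j (P j)) P

lemma prodProb_univ {μ : ι → Ω → ℝ} (h1 : ∀ j, ∑ ω, μ j ω = 1) :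
    prodProb μ Set.univ = 1 := by
  simp [prodProb, sum_prod_eq_one h1]

lemma prodProb_le_one {μ : ι → Ω → ℝ} (h0 : ∀ j ω, 0 ≤ μ j ω)
    (h1 : ∀ j, ∑ ω, μ j ω = 1) (A : Set (ι → Ω)) : prodProb μ A ≤ 1 :=
  (prodProb_mono h0 (Set.subset_univ A)).trans_eq (prodProb_univ h1)

/-- Union bound for the complement of a finite intersection. -/
lemma one_le_prodProb_add_sum {κ : Type*} [Fintype κ] {μ : ι → Ω → ℝ}
    (h0 : ∀ j ω, 0 ≤ μ j ω) (h1 : ∀ j, ∑ ω, μ j ω = 1)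
    (A : Set (ι → Ω)) (B : κ → Set (ι → Ω)) (hAB : ∀ P, (∀ i, P ∉ B i) → P ∈ A) :
    1 ≤ prodProb μ A + ∑ i, prodProb μ (B i) := by
  rw [← prodProb_univ h1]
  unfold prodProb
  rw [Finset.sum_comm, ← Finset.sum_add_distrib]
  refine Finset.sum_le_sum fun P _ => ?_
  have hw : ∀ P : ι → Ω, 0 ≤ ∏ j, μ j (P j) := fun P => Finset.prod_nonneg fun j _ => h0 j (P j)
  have hB : ∀ i, 0 ≤ (B i).indicator (fun P => ∏ j, μ j (P j)) P :=
    fun i => Set.indicator_nonneg (fun P _ => hw P) P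
  have hA : 0 ≤ A.indicator (fun P => ∏ j, μ j (P j)) P :=
    Set.indicator_nonneg (fun P _ => hw P) P
  by_cases h : ∀ i, P ∉ B i
  · have := hAB P h
    simp only [Set.indicator_univ, Set.indicator_of_mem this]
    linarith [Finset.sum_nonneg fun i (_ : i ∈ Finset.univ) => hB i]
  · push Not at h
    obtain ⟨i, hi⟩ := h
    have := Finset.single_le_sum (fun i _ => hB i) (Finset.mem_univ i)
    rw [Set.indicator_of_mem hi] at this
    simp only [Set.indicator_univ]
    linarith

lemma sum_prod_mul_mul_eq_zero {μ g : ι → Ω → ℝ} (hg : ∀ j, ∑ ω, μ j ω * g j ω = 0)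
    {j k : ι} (hjk : j ≠ k) :
    ∑ P : ι → Ω, (∏ l, μ l (P l)) * (g j (P j) * g k (P k)) = 0 := by
  have key : ∀ P : ι → Ω, (∏ l, μ l (P l)) * (g j (P j) * g k (P k)) =
      ∏ l, (μ l (P l) * (if l = j then g l (P l) else 1) * (if l = k then g l (P l) else 1)) := by
    intro P
    rw [Finset.prod_mul_distrib, Finset.prod_mul_distrib, Finset.prod_ite_eq', Finset.prod_ite_eq']
    simp [mul_assoc]
  simp_rw [key]
  rw [← Fintype.prod_sum (fun l ω =>
    μ l ω * (if l = j then g l ω else 1) * (if l = k then g l ω else 1))]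
  refine Finset.prod_eq_zero (Finset.mem_univ j) ?_
  simpa [hjk] using hg j

lemma sum_prod_mul_apply {μ : ι → Ω → ℝ} (h1 : ∀ j, ∑ ω, μ j ω = 1) (j : ι) (g : Ω → ℝ) :
    ∑ P : ι → Ω, (∏ l, μ l (P l)) * g (P j) = ∑ ω, μ j ω * g ω := by
  have key : ∀ P : ι → Ω, (∏ l, μ l (P l)) * g (P j) =
      ∏ l, (μ l (P l) * (if l = j then g (P l) else 1)) := by
    intro P
    rw [Finset.prod_mul_distrib, Finset.prod_ite_eq']
    simp
  simp_rw [key]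
  rw [← Fintype.prod_sum (fun l ω => μ l ω * (if l = j then g ω else 1)),
    Finset.prod_eq_single j]
  · simp
  · intro l _ hl
    simp [hl, h1]
  · simp

lemma sum_prod_mul_sq_le {μ g : ι → Ω → ℝ} (h0 : ∀ j ω, 0 ≤ μ j ω)
    (h1 : ∀ j, ∑ ω, μ j ω = 1) (hg : ∀ j, ∑ ω, μ j ω * g j ω = 0)
    (hg1 : ∀ j ω, g j ω ^ 2 ≤ 1) :
    ∑ P : ι → Ω, (∏ l, μ l (P l)) * (∑ j, g j (P j)) ^ 2 ≤ Fintype.card ι := by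
  have h : ∀ P : ι → Ω, (∏ l, μ l (P l)) * (∑ j, g j (P j)) ^ 2 =
      ∑ j, ∑ k, (∏ l, μ l (P l)) * (g j (P j) * g k (P k)) := by
    intro P
    rw [sq, Finset.sum_mul_sum, Finset.mul_sum]
    exact Finset.sum_congr rfl fun j _ => Finset.mul_sum _ _ _
  simp_rw [h]
  rw [Finset.sum_comm]
  have hj : ∀ j ∈ (Finset.univ : Finset ι),
      ∑ P : ι → Ω, ∑ k, (∏ l, μ l (P l)) * (g j (P j) * g k (P k)) ≤ 1 := by
    intro j _
    rw [Finset.sum_comm, Finset.sum_eq_single j]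
    · have := sum_prod_mul_apply h1 j (fun ω => g j ω * g j ω)
      rw [this, ← h1 j]
      refine Finset.sum_le_sum fun ω _ => ?_
      nlinarith [h0 j ω, hg1 j ω]
    · intro k _ hk
      exact sum_prod_mul_mul_eq_zero hg hk.symm
    · simp
  simpa using Finset.sum_le_sum hj

/-- Chebyshev's inequality for the number of coordinates in `S`. -/
lemma prodProb_countIn_le [DecidableEq Ω] {μ : ι → Ω → ℝ} (h0 : ∀ j ω, 0 ≤ μ j ω)
    (h1 : ∀ j, ∑ ω, μ j ω = 1) (S : Finset Ω) {t : ℝ} (ht : 0 < t) :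
    prodProb μ {P | t ≤ |(countIn S P : ℝ) - ∑ j, ∑ ω ∈ S, μ j ω|} ≤
      Fintype.card ι / t ^ 2 := by
  set e : ι → ℝ := fun j => ∑ ω ∈ S, μ j ω with he
  have he0 : ∀ j, 0 ≤ e j := fun j => Finset.sum_nonneg fun ω _ => h0 j ω
  have he1 : ∀ j, e j ≤ 1 := fun j => by
    rw [← h1 j]
    exact Finset.sum_le_sum_of_subset_of_nonneg (Finset.subset_univ S) fun ω _ _ => h0 j ω
  have hcount : ∀ P : ι → Ω, (countIn S P : ℝ) - ∑ j, e j =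
      ∑ j, ((if P j ∈ S then (1 : ℝ) else 0) - e j) := by
    intro P
    rw [Finset.sum_sub_distrib]
    simp [countIn]
  have hvar := sum_prod_mul_sq_le (g := fun j ω => (if ω ∈ S then (1 : ℝ) else 0) - e j) h0 h1
    (by
      intro j
      simp [mul_sub, Finset.sum_sub_distrib, ← Finset.sum_mul, h1, he, Finset.sum_ite_mem])
    (by
      intro j ω
      have := he0 j
      have := he1 j
      split_ifs <;> nlinarith)
  rw [le_div_iff₀ (by positivity)]
  refine le_trans ?_ hvar
  unfold prodProb
  rw [Finset.sum_mul]
  refine Finset.sum_le_sum fun P _ => ?_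
  have hw : 0 ≤ ∏ j, μ j (P j) := Finset.prod_nonneg fun j _ => h0 j (P j)
  rw [← hcount]
  by_cases hP : P ∈ {P : ι → Ω | t ≤ |(countIn S P : ℝ) - ∑ j, e j|}
  · rw [Set.indicator_of_mem hP]
    refine mul_le_mul_of_nonneg_left ?_ hw
    rw [← sq_abs ((countIn S P : ℝ) - ∑ j, e j)]
    exact pow_le_pow_left₀ ht.le hP 2
  · rw [Set.indicator_of_notMem hP, zero_mul]
    exact mul_nonneg hw (sq_nonneg _)

/-- Change of measure: a perturbation of order `card ι ^ (-1/2)` changes the order of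
magnitude of probabilities only by a bounded factor. -/
lemma sq_prodProb_le_of_perturb {μ ν : ι → Ω → ℝ} {v : Ω → ℝ} {s ε : ℝ} (hε : 0 < ε)
    (hμ : ∀ j ω, ε ≤ μ j ω) (h1 : ∀ j, ∑ ω, μ j ω = 1)
    (hν : ∀ j ω, ν j ω = μ j ω + s * v ω) (hv : ∑ ω, v ω = 0)
    (hs : s ^ 2 * Fintype.card ι ≤ 1) (A : Set (ι → Ω)) :
    prodProb ν A ^ 2 ≤ prodProb μ A * Real.exp ((∑ ω, v ω ^ 2) / ε) := by
  have hμ0 : ∀ j ω, 0 < μ j ω := fun j ω => hε.trans_le (hμ j ω)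
  have hw : ∀ P : ι → Ω, 0 < ∏ j, μ j (P j) := fun P => Finset.prod_pos fun j _ => hμ0 j (P j)
  have hCS : prodProb ν A ^ 2 ≤ prodProb μ A * ∑ P : ι → Ω, ∏ j, (ν j (P j) ^ 2 / μ j (P j)) := by
    refine Finset.sum_sq_le_sum_mul_sum_of_sq_le_mul _
      (fun P _ => Set.indicator_nonneg (fun P _ => (hw P).le) P)
      (fun P _ => Finset.prod_nonneg fun j _ => div_nonneg (sq_nonneg _) (hμ0 _ _).le)
      (fun P _ => ?_)
    by_cases hP : P ∈ A
    · rw [Set.indicator_of_mem hP, Set.indicator_of_mem hP, Finset.prod_div_distrib,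
        Finset.prod_pow, mul_div_cancel₀ _ (hw P).ne']
    · simp [Set.indicator_of_notMem hP]
  refine hCS.trans (mul_le_mul_of_nonneg_left ?_ (prodProb_nonneg (fun j ω => (hμ0 j ω).le) A))
  rw [← Fintype.prod_sum (fun j ω => ν j ω ^ 2 / μ j ω)]
  set V := ∑ ω, v ω ^ 2 with hV
  have hV0 : 0 ≤ V := Finset.sum_nonneg fun _ _ => sq_nonneg _
  have hfac : ∀ j ∈ (Finset.univ : Finset ι),
      ∑ ω, ν j ω ^ 2 / μ j ω ≤ Real.exp (s ^ 2 * (V / ε)) := by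
    intro j _
    have hterm : ∀ ω ∈ (Finset.univ : Finset Ω),
        ν j ω ^ 2 / μ j ω ≤ μ j ω + 2 * s * v ω + s ^ 2 / ε * v ω ^ 2 := by
      intro ω _
      have h2 : ν j ω ^ 2 / μ j ω = μ j ω + 2 * s * v ω + s ^ 2 * v ω ^ 2 / μ j ω := by
        rw [hν]
        field_simp [(hμ0 j ω).ne']
        ring
      have h3 : s ^ 2 * v ω ^ 2 / μ j ω ≤ s ^ 2 * v ω ^ 2 / ε :=
        div_le_div_of_nonneg_left (by positivity) hε (hμ j ω)
      rw [h2]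
      have h4 : s ^ 2 / ε * v ω ^ 2 = s ^ 2 * v ω ^ 2 / ε := by ring
      linarith
    have := Finset.sum_le_sum hterm
    rw [Finset.sum_add_distrib, Finset.sum_add_distrib, ← Finset.mul_sum, ← Finset.mul_sum, h1,
      hv, ← hV] at this
    refine this.trans ?_
    have := Real.add_one_le_exp (s ^ 2 * (V / ε))
    have h5 : s ^ 2 / ε * V = s ^ 2 * (V / ε) := by ring
    linarith
  refine (Finset.prod_le_prod (fun j _ => Finset.sum_nonneg fun ω _ =>
    div_nonneg (sq_nonneg _) (hμ0 _ _).le) hfac).trans ?_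
  rw [Finset.prod_const, ← Real.exp_nat_mul, Real.exp_le_exp, Finset.card_univ]
  have : 0 ≤ V / ε := by positivity
  nlinarith

end ProductProbability

section Binomial

/-- The probability that a binomial random variable with parameters `N`, `p` equals `m`. -/
def binomProb (N : ℕ) (p : ℝ) (m : ℕ) : ℝ :=
  (N.choose m : ℝ) * p ^ m * (1 - p) ^ (N - m)

lemma binomProb_nonneg {p : ℝ} (hp0 : 0 ≤ p) (hp1 : p ≤ 1) (N m : ℕ) :
    0 ≤ binomProb N p m := by
  have : 0 ≤ 1 - p := by linarith
  unfold binomProb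
  positivity

lemma sum_binomProb (N : ℕ) (p : ℝ) : ∑ m ∈ Finset.range (N + 1), binomProb N p m = 1 := by
  have := congrArg (Polynomial.eval p) (bernsteinPolynomial.sum ℝ N)
  simpa [Polynomial.eval_finsetSum, bernsteinPolynomial, binomProb] using this

lemma variance_binomProb (N : ℕ) (p : ℝ) :
    ∑ m ∈ Finset.range (N + 1), (N * p - m) ^ 2 * binomProb N p m = N * p * (1 - p) := by
  have := congrArg (Polynomial.eval p) (bernsteinPolynomial.variance ℝ N)
  simpa [Polynomial.eval_finsetSum, bernsteinPolynomial, binomProb] using this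

lemma binomProb_succ {N m : ℕ} (hm : m < N) (p : ℝ) :
    ((m : ℝ) + 1) * (1 - p) * binomProb N p (m + 1) = ((N : ℝ) - m) * p * binomProb N p m := by
  have h := congrArg (Nat.cast (R := ℝ)) (Nat.choose_succ_right_eq N m)
  push_cast [Nat.cast_sub hm.le] at h
  unfold binomProb
  obtain ⟨k, rfl⟩ := Nat.exists_eq_add_of_lt hm
  have e1 : m + k + 1 - m = k + 1 := by omega
  have e2 : m + k + 1 - (m + 1) = k := by omega
  rw [e1, e2, pow_succ, pow_succ]
  linear_combination (p ^ m * p * (1 - p) ^ k * (1 - p)) * h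

/-- Some value within one standard scale of the mean is taken with probability `≳ N^(-1/2)`. -/
lemma exists_binomProb_ge {N : ℕ} (hN : 1 ≤ N) {p : ℝ} (hp0 : 0 ≤ p) (hp1 : p ≤ 1) :
    ∃ m : ℕ, |(m : ℝ) - N * p| ≤ √N ∧ 1 / (8 * √N) ≤ binomProb N p m := by
  have hN' : (1 : ℝ) ≤ N := by exact_mod_cast hN
  have hr : 1 ≤ √(N : ℝ) := by rwa [Real.one_le_sqrt]
  have hsq : √(N : ℝ) ^ 2 = N := Real.sq_sqrt (by positivity)
  set W := (Finset.range (N + 1)).filter (fun m : ℕ => |(m : ℝ) - N * p| ≤ √N) with hW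
  have hsum : 3 / 4 ≤ ∑ m ∈ W, binomProb N p m := by
    have h : ∀ m ∈ Finset.range (N + 1), binomProb N p m ≤
        (if |(m : ℝ) - N * p| ≤ √N then binomProb N p m else 0) +
          (1 / (N : ℝ)) * ((N * p - m) ^ 2 * binomProb N p m) := by
      intro m _
      have hb := binomProb_nonneg hp0 hp1 N m
      split_ifs with hm
      · have : 0 ≤ (1 / (N : ℝ)) * ((N * p - m) ^ 2 * binomProb N p m) := by positivity
        linarith
      · push Not at hm
        have h2 : (N : ℝ) ≤ (N * p - m) ^ 2 := by
          calc (N : ℝ) = √N ^ 2 := hsq.symm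
            _ ≤ |(m : ℝ) - N * p| ^ 2 := pow_le_pow_left₀ (by positivity) hm.le 2
            _ = (N * p - m) ^ 2 := by rw [sq_abs]; ring
        have h3 : 1 ≤ (1 / (N : ℝ)) * (N * p - m) ^ 2 := by
          rw [one_div, ← div_eq_inv_mul, le_div_iff₀ (by positivity)]
          linarith
        nlinarith
    have := Finset.sum_le_sum h
    rw [Finset.sum_add_distrib, ← Finset.mul_sum, sum_binomProb, variance_binomProb,
      ← Finset.sum_filter, ← hW] at this
    have h4 : 1 / (N : ℝ) * (N * p * (1 - p)) = p * (1 - p) := by field_simp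
    rw [h4] at this
    nlinarith [sq_nonneg (p - 1 / 2)]
  have hcard : (W.card : ℝ) ≤ 3 * √N := by
    have hsub : W ⊆ Finset.Icc ⌈N * p - √N⌉₊ ⌊N * p + √N⌋₊ := by
      intro m hm
      have hm' := abs_le.mp (Finset.mem_filter.mp hm).2
      rw [Finset.mem_Icc]
      exact ⟨Nat.ceil_le.mpr (by linarith), Nat.le_floor (by linarith)⟩
    have h1 : (W.card : ℝ) ≤ ((⌊N * p + √N⌋₊ + 1 - ⌈N * p - √N⌉₊ : ℕ) : ℝ) := by
      rw [← Nat.card_Icc]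
      exact_mod_cast Finset.card_le_card hsub
    have h2 := Nat.floor_le (a := N * p + √(N : ℝ)) (by positivity)
    have h3 := Nat.le_ceil (N * p - √(N : ℝ))
    refine h1.trans ?_
    rcases le_total ⌈N * p - √(N : ℝ)⌉₊ (⌊N * p + √(N : ℝ)⌋₊ + 1) with h | h
    · push_cast [Nat.cast_sub h]
      linarith
    · rw [Nat.sub_eq_zero_of_le h]
      push_cast
      positivity
  by_contra! hcon
  have h5 : ∀ m ∈ W, binomProb N p m ≤ 1 / (8 * √N) := fun m hm =>
    (hcon m (Finset.mem_filter.mp hm).2).le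
  have h6 := Finset.sum_le_card_nsmul W _ _ h5
  rw [nsmul_eq_mul] at h6
  have h7 : (W.card : ℝ) * (1 / (8 * √N)) ≤ 3 * √N * (1 / (8 * √N)) :=
    mul_le_mul_of_nonneg_right hcard (by positivity)
  have h8 : 3 * √(N : ℝ) * (1 / (8 * √N)) = 3 / 8 := by field_simp
  linarith

lemma binomProb_step {N m : ℕ} {p y : ℝ} (hp0 : 0 < p) (hp1 : p < 1)
    (hy : y < N * (p * (1 - p))) (hm : |(m : ℝ) - N * p| ≤ y)
    (hm1 : |((m + 1 : ℕ) : ℝ) - N * p| ≤ y) :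
    (1 - 2 * y / (N * (p * (1 - p)))) * binomProb N p (m + 1) ≤ binomProb N p m ∧
    (1 - 2 * y / (N * (p * (1 - p)))) * binomProb N p m ≤ binomProb N p (m + 1) := by
  have hq0 : 0 < 1 - p := by linarith
  have hy0 : 0 ≤ y := (abs_nonneg _).trans hm
  set V := N * (p * (1 - p)) with hV
  have hV0 : 0 < V := hy0.trans_lt hy
  push_cast at hm1
  rw [abs_le] at hm hm1
  have hlt : m < N := by
    have : (m : ℝ) < N := by nlinarith
    exact_mod_cast this
  have key := binomProb_succ hlt p
  have hb := binomProb_nonneg hp0.le hp1.le N m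
  have hb1 := binomProb_nonneg hp0.le hp1.le N (m + 1)
  have hρ : (1 - 2 * y / V) * (V + y) ≤ V - y := by
    have : (1 - 2 * y / V) * (V + y) = V - y - 2 * y ^ 2 / V := by field_simp; ring
    rw [this]
    have : 0 ≤ 2 * y ^ 2 / V := by positivity
    linarith
  have l1 : V - y ≤ ((m : ℝ) + 1) * (1 - p) := by nlinarith
  have u1 : ((m : ℝ) + 1) * (1 - p) ≤ V + y := by nlinarith
  have l2 : V - y ≤ ((N : ℝ) - m) * p := by nlinarith
  have u2 : ((N : ℝ) - m) * p ≤ V + y := by nlinarith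
  have hVy : 0 < V + y := by linarith
  constructor
  · refine le_of_mul_le_mul_left ?_ hVy
    calc (V + y) * ((1 - 2 * y / V) * binomProb N p (m + 1))
        = ((1 - 2 * y / V) * (V + y)) * binomProb N p (m + 1) := by ring
      _ ≤ ((m : ℝ) + 1) * (1 - p) * binomProb N p (m + 1) :=
        mul_le_mul_of_nonneg_right (hρ.trans l1) hb1
      _ = ((N : ℝ) - m) * p * binomProb N p m := key
      _ ≤ (V + y) * binomProb N p m := mul_le_mul_of_nonneg_right u2 hb
  · refine le_of_mul_le_mul_left ?_ hVy
    calc (V + y) * ((1 - 2 * y / V) * binomProb N p m)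
        = ((1 - 2 * y / V) * (V + y)) * binomProb N p m := by ring
      _ ≤ ((N : ℝ) - m) * p * binomProb N p m :=
        mul_le_mul_of_nonneg_right (hρ.trans l2) hb
      _ = ((m : ℝ) + 1) * (1 - p) * binomProb N p (m + 1) := key.symm
      _ ≤ (V + y) * binomProb N p (m + 1) := mul_le_mul_of_nonneg_right u1 hb1

lemma binomProb_chain {N : ℕ} {p y : ℝ} (hp0 : 0 < p) (hp1 : p < 1)
    (hy : 2 * y < N * (p * (1 - p))) (s : ℕ) : ∀ m : ℕ, |(m : ℝ) - N * p| ≤ y →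
    |((m + s : ℕ) : ℝ) - N * p| ≤ y →
    (1 - 2 * y / (N * (p * (1 - p)))) ^ s * binomProb N p (m + s) ≤ binomProb N p m ∧
    (1 - 2 * y / (N * (p * (1 - p)))) ^ s * binomProb N p m ≤ binomProb N p (m + s) := by
  induction s with
  | zero => intro m _ _; simp
  | succ s ih =>
    intro m hm hms
    have hy0 : 0 ≤ y := (abs_nonneg _).trans hm
    have hρ : 0 ≤ 1 - 2 * y / (N * (p * (1 - p))) := by
      rw [sub_nonneg, div_le_one (by linarith)]
      exact hy.le
    have hms' : |((m + s : ℕ) : ℝ) - N * p| ≤ y := by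
      rw [abs_le] at hm hms ⊢
      push_cast at hms ⊢
      have : (0 : ℝ) ≤ s := Nat.cast_nonneg s
      constructor <;> linarith
    obtain ⟨a1, a2⟩ := ih m hm hms'
    obtain ⟨b1, b2⟩ := binomProb_step hp0 hp1 (by linarith) hms' hms
    constructor
    · refine le_trans ?_ a1
      rw [pow_succ, mul_assoc]
      exact mul_le_mul_of_nonneg_left b1 (pow_nonneg hρ s)
    · refine le_trans ?_ b2
      rw [pow_succ, mul_comm _ (1 - _), mul_assoc]
      exact mul_le_mul_of_nonneg_left a2 hρ

/-- A local lower bound for binomial probabilities at the standard scale around the mean. -/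
lemma exists_binomProb_lower_bound {p C : ℝ} (hp0 : 0 < p) (hp1 : p < 1) (hC : 1 ≤ C) :
    ∃ c > (0 : ℝ), ∃ N₀ : ℕ, ∀ N : ℕ, N₀ ≤ N → ∀ m : ℕ, |(m : ℝ) - N * p| ≤ C * √N →
      c / √N ≤ binomProb N p m := by
  set v := p * (1 - p) with hv
  have hv0 : 0 < v := mul_pos hp0 (by linarith)
  refine ⟨Real.exp (-(8 * C ^ 2 / v)) / 8, by positivity, ⌈(4 * C / v) ^ 2⌉₊ + 1,
    fun N hN m hm => ?_⟩
  have hN1 : 1 ≤ N := le_trans (Nat.le_add_left 1 _) hN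
  have hNr : (4 * C / v) ^ 2 ≤ N := by
    refine (Nat.le_ceil _).trans ?_
    exact_mod_cast (Nat.le_succ _).trans hN
  have hrpos : 0 < √(N : ℝ) := Real.sqrt_pos.mpr (by exact_mod_cast hN1)
  have hsq : √(N : ℝ) * √N = N := Real.mul_self_sqrt (by positivity)
  have hr : 4 * C / v ≤ √N := Real.le_sqrt_of_sq_le hNr
  have hr' : 4 * C ≤ √N * v := by rwa [div_le_iff₀ hv0] at hr
  set y := C * √N with hy
  have hy2 : 4 * y ≤ N * v := by
    have h : N * v = √N * (√N * v) := by linear_combination (-v) * hsq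
    rw [h, hy]
    nlinarith
  have hy0 : 0 < y := by positivity
  obtain ⟨m₀, hm₀, hb⟩ := exists_binomProb_ge hN1 hp0.le hp1.le
  have hm₀' : |(m₀ : ℝ) - N * p| ≤ y := hm₀.trans (by nlinarith)
  set x := 2 * y / (N * v) with hx
  have hNv : 0 < N * v := by linarith
  have hx0 : 0 ≤ x := by positivity
  have hx1 : x ≤ 1 / 2 := by
    rw [hx, div_le_iff₀ hNv]
    linarith
  have hxexp : Real.exp (-(2 * x)) ≤ 1 - x := by
    have h1 := Real.add_one_le_exp (2 * x)
    rw [Real.exp_neg, inv_le_comm₀ (Real.exp_pos _) (by linarith)]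
    refine le_trans ?_ h1
    rw [inv_le_iff_one_le_mul₀ (by linarith)]
    nlinarith
  have hpow : ∀ s : ℕ, (s : ℝ) ≤ 2 * y → Real.exp (-(8 * C ^ 2 / v)) ≤ (1 - x) ^ s := by
    intro s hs
    refine le_trans ?_ (pow_le_pow_left₀ (Real.exp_pos _).le hxexp s)
    rw [← Real.exp_nat_mul, Real.exp_le_exp]
    have h1 : (s : ℝ) * (2 * x) ≤ 2 * y * (2 * x) := mul_le_mul_of_nonneg_right hs (by positivity)
    have h2 : 2 * y * (2 * x) = 8 * C ^ 2 / v := by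
      have hyy : y * y = C ^ 2 * N := by rw [hy]; linear_combination C ^ 2 * hsq
      have hN0 : (N : ℝ) ≠ 0 := (by exact_mod_cast hN1 : (0 : ℝ) < N).ne'
      calc 2 * y * (2 * x) = 8 * (y * y) / (N * v) := by rw [hx]; ring
        _ = 8 * C ^ 2 / v := by rw [hyy]; field_simp
    linarith
  have hfinal : ∃ s : ℕ, (s : ℝ) ≤ 2 * y ∧ (1 - x) ^ s * binomProb N p m₀ ≤ binomProb N p m := by
    rw [abs_le] at hm hm₀'
    rcases le_total m m₀ with h | h
    · obtain ⟨s, rfl⟩ := Nat.exists_eq_add_of_le h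
      refine ⟨s, ?_, (binomProb_chain hp0 hp1 (by linarith) s m (abs_le.mpr hm)
        (abs_le.mpr hm₀')).1⟩
      push_cast at hm₀'
      linarith
    · obtain ⟨s, rfl⟩ := Nat.exists_eq_add_of_le h
      refine ⟨s, ?_, (binomProb_chain hp0 hp1 (by linarith) s m₀ (abs_le.mpr hm₀')
        (abs_le.mpr hm)).2⟩
      push_cast at hm
      linarith
  obtain ⟨s, hs, hle⟩ := hfinal
  refine le_trans ?_ hle
  calc Real.exp (-(8 * C ^ 2 / v)) / 8 / √N = Real.exp (-(8 * C ^ 2 / v)) * (1 / (8 * √N)) := by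
        field_simp
    _ ≤ (1 - x) ^ s * binomProb N p m₀ :=
        mul_le_mul (hpow s hs) hb (by positivity) (pow_nonneg (by linarith) s)

end Binomial

lemma countIn_subtype_add {ι Ω : Type*} [Fintype ι] [DecidableEq Ω] (S : Finset Ω)
    (s : ι → Prop) [DecidablePred s] (P : ι → Ω) :
    countIn S (fun j : {j // s j} => P j) + countIn S (fun j : {j // ¬ s j} => P j) =
      countIn S P := by
  unfold countIn
  simp only [Finset.card_filter]
  exact Fintype.sum_subtype_add_sum_subtype s (fun j => if P j ∈ S then 1 else 0)

section LocalBound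

variable {ι Ω : Type*} [Fintype ι] [DecidableEq ι] [Fintype Ω] [DecidableEq Ω]

/-- For identically distributed coordinates the count of coordinates in `S` is binomial. -/
lemma prodProb_const_countIn_eq {w : Ω → ℝ} (h1 : ∑ ω, w ω = 1) (S : Finset Ω) (m : ℕ) :
    prodProb (fun _ : ι => w) {P | countIn S P = m} =
      binomProb (Fintype.card ι) (∑ ω ∈ S, w ω) m := by
  open Polynomial in
  set a := ∑ ω ∈ S, w ω with ha
  set N := Fintype.card ι with hN
  have hfac : ∑ ω, C (w ω) * X ^ (if ω ∈ S then 1 else 0) = C a * X + C (1 - a) := by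
    have h2 : ∀ ω, C (w ω) * X ^ (if ω ∈ S then 1 else 0) =
        (if ω ∈ S then C (w ω) else 0) * X + (C (w ω) - (if ω ∈ S then C (w ω) else 0)) := by
      intro ω
      split_ifs <;> simp
    simp_rw [h2]
    rw [Finset.sum_add_distrib, ← Finset.sum_mul, Finset.sum_sub_distrib, Finset.sum_ite_mem,
      Finset.univ_inter, ← map_sum, ← map_sum, h1, ← ha, C_sub]
  have hgen : ∑ P : ι → Ω, C (∏ j, w (P j)) * X ^ countIn S P = (C a * X + C (1 - a)) ^ N := by
    rw [← hfac, hN, ← Finset.card_univ, ← Finset.prod_const,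
      Fintype.prod_sum (fun _ ω => C (w ω) * X ^ (if ω ∈ S then 1 else 0))]
    refine Finset.sum_congr rfl fun P _ => ?_
    rw [Finset.prod_mul_distrib, ← map_prod, Finset.prod_pow_eq_pow_sum]
    simp [countIn]
  have hL : (∑ P : ι → Ω, C (∏ j, w (P j)) * X ^ countIn S P).coeff m =
      prodProb (fun _ : ι => w) {P | countIn S P = m} := by
    rw [finsetSum_coeff]
    refine Finset.sum_congr rfl fun P _ => ?_
    rw [coeff_C_mul_X_pow, Set.indicator_apply]
    simp [eq_comm]
  have hR : ((C a * X + C (1 - a)) ^ N).coeff m = binomProb N a m := by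
    have h3 : (C a * X + C (1 - a)) ^ N =
        ∑ k ∈ Finset.range (N + 1), C (binomProb N a k) * X ^ k := by
      rw [add_pow]
      refine Finset.sum_congr rfl fun k _ => ?_
      simp only [binomProb, map_mul, map_pow, mul_pow, map_natCast]
      ring
    rw [h3, finsetSum_coeff]
    simp_rw [coeff_C_mul_X_pow]
    rw [Finset.sum_ite_eq]
    split_ifs with h
    · rfl
    · rw [Finset.mem_range, not_lt] at h
      simp [binomProb, Nat.choose_eq_zero_of_lt (Nat.lt_of_succ_le h)]
  rw [← hL, hgen, hR]

lemma prodProb_countIn_eq_sum (μ : ι → Ω → ℝ) (S : Finset Ω) (s : ι → Prop) [DecidablePred s]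
    (k : ℕ) :
    prodProb μ {P | countIn S P = k} =
      ∑ P₂ : {j // ¬ s j} → Ω, (∏ j : {j // ¬ s j}, μ j (P₂ j)) *
        prodProb (fun j : {j // s j} => μ j) {P₁ | countIn S P₁ + countIn S P₂ = k} := by
  have h : prodProb μ {P | countIn S P = k} =
      ∑ R : ({j // s j} → Ω) × ({j // ¬ s j} → Ω),
        (∏ j : {j // ¬ s j}, μ j (R.2 j)) * Set.indicator {P₁ | countIn S P₁ + countIn S R.2 = k}
          (fun P₁ => ∏ j : {j // s j}, μ j (P₁ j)) R.1 := by
    refine Fintype.sum_equiv (Equiv.piEquivPiSubtypeProd s (fun _ => Ω)) _ _ fun P => ?_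
    simp only [Set.indicator_apply, Set.mem_ofPred_eq, Equiv.piEquivPiSubtypeProd_apply,
      countIn_subtype_add, ← Fintype.prod_subtype_mul_prod_subtype s (fun j => μ j (P j))]
    split_ifs
    · exact mul_comm _ _
    · exact (mul_zero _).symm
  rw [h, Fintype.sum_prod_type, Finset.sum_comm]
  refine Finset.sum_congr rfl fun P₂ _ => ?_
  rw [prodProb, Finset.mul_sum]

/-- A local lower bound for the count of coordinates in `S` when a positive fraction of the
coordinates is identically distributed. -/
lemma exists_prodProb_countIn_eq_lower_bound (S : Finset Ω) {a l C : ℝ} (ha0 : 0 < a)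
    (ha1 : a < 1) (hl : 0 < l) (hC : 0 ≤ C) {w : Ω → ℝ} (hw1 : ∑ ω, w ω = 1)
    (hwS : ∑ ω ∈ S, w ω = a) :
    ∃ c > (0 : ℝ), ∃ N₀ : ℕ, ∀ n : ℕ, N₀ ≤ n → ∀ μ : Fin n → Ω → ℝ, (∀ j ω, 0 ≤ μ j ω) →
      (∀ j, ∑ ω, μ j ω = 1) → ∀ (s : Fin n → Prop) [DecidablePred s], (∀ j, s j → μ j = w) →
      l * n ≤ Fintype.card {j // s j} →
      ∀ k : ℕ, |∑ j, ∑ ω ∈ S, μ j ω - k| ≤ C →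
      c / √n ≤ prodProb μ {P | countIn S P = k} := by
  set C' := (2 + C) / √l + 1 with hC'
  have hsl : 0 < √l := Real.sqrt_pos.mpr hl
  have hC'1 : 1 ≤ C' := by
    have : 0 ≤ (2 + C) / √l := by positivity
    linarith
  obtain ⟨c, hc, N₀, hbin⟩ := exists_binomProb_lower_bound ha0 ha1 hC'1
  refine ⟨3 / 4 * c, by positivity,
    ⌈N₀ / l⌉₊ + ⌈((2 + C) / (l * a)) ^ 2⌉₊ + 1, fun n hn μ h0 h1 s _ hT hNl k hk => ?_⟩
  have hn1 : (1 : ℝ) ≤ n := by exact_mod_cast (Nat.le_add_left 1 _).trans hn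
  have hnN : (N₀ : ℝ) / l ≤ n := (Nat.le_ceil _).trans (by exact_mod_cast by omega)
  have hnsq : ((2 + C) / (l * a)) ^ 2 ≤ (n : ℝ) :=
    (Nat.le_ceil _).trans (by exact_mod_cast by omega)
  have hr : 1 ≤ √(n : ℝ) := by rwa [Real.one_le_sqrt]
  have hsq : √(n : ℝ) * √n = n := Real.mul_self_sqrt (by positivity)
  have hr2 : 2 + C ≤ √(n : ℝ) * (l * a) := by
    rw [← div_le_iff₀ (by positivity)]
    exact Real.le_sqrt_of_sq_le hnsq
  set N := Fintype.card {j // s j} with hN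
  have hNn : (N : ℝ) ≤ n := by
    exact_mod_cast (Fintype.card_subtype_le s).trans_eq (Fintype.card_fin n)
  have hNN₀ : N₀ ≤ N := by
    rw [div_le_iff₀ hl] at hnN
    have : (N₀ : ℝ) ≤ N := by linarith
    exact_mod_cast this
  have hNpos : (0 : ℝ) < N := lt_of_lt_of_le (by positivity) hNl
  have hsqrtN : √l * √n ≤ √(N : ℝ) := by
    rw [← Real.sqrt_mul hl.le]
    exact Real.sqrt_le_sqrt hNl
  rw [prodProb_countIn_eq_sum μ S s]
  set μ₂ : {j // ¬ s j} → Ω → ℝ := fun j => μ j with hμ₂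
  set E := ∑ j, ∑ ω ∈ S, μ₂ j ω with hE
  set bad : Set ({j // ¬ s j} → Ω) := {P | 2 * √n ≤ |(countIn S P : ℝ) - E|} with hbad
  have hcheb : prodProb μ₂ bad ≤ 1 / 4 := by
    have h := prodProb_countIn_le (μ := μ₂) (fun j => h0 j) (fun j => h1 j) S
      (t := 2 * √n) (by positivity)
    refine h.trans ?_
    have hM : (Fintype.card {j // ¬ s j} : ℝ) ≤ n := by
      exact_mod_cast (Fintype.card_subtype_le _).trans_eq (Fintype.card_fin n)
    rw [mul_pow, sq (√(n : ℝ)), hsq, div_le_iff₀ (by positivity)]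
    linarith
  have hgood : 3 / 4 ≤ prodProb μ₂ badᶜ := by
    have := one_le_prodProb_add_sum (κ := Unit) (μ := μ₂) (fun j => h0 j) (fun j => h1 j) badᶜ
      (fun _ => bad) (fun P hP => hP ())
    simp only [Finset.univ_unique, Finset.sum_const, Finset.card_singleton, one_smul] at this
    linarith
  have hsplit : ∑ j, ∑ ω ∈ S, μ j ω = N * a + E := by
    rw [← Fintype.sum_subtype_add_sum_subtype s (fun j => ∑ ω ∈ S, μ j ω), hE]
    congr 1
    rw [Finset.sum_congr rfl (g := fun _ => a), Finset.sum_const, nsmul_eq_mul,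
      Finset.card_univ, hN]
    intro j _
    rw [hT j j.2, hwS]
  have hstep : ∀ P₂ ∈ badᶜ, c / √n ≤
      prodProb (fun j : {j // s j} => μ j) {P₁ | countIn S P₁ + countIn S P₂ = k} := by
    intro P₂ hP₂
    have hP : |(countIn S P₂ : ℝ) - E| < 2 * √n := not_le.mp hP₂
    rw [abs_lt] at hP
    rw [abs_le, hsplit] at hk
    have hkge : countIn S P₂ ≤ k := by
      have h2 : (2 + C) * √n ≤ N * a := by
        calc (2 + C) * √n ≤ √(n : ℝ) * (l * a) * √n :=
              mul_le_mul_of_nonneg_right hr2 (by positivity)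
          _ = l * (√(n : ℝ) * √n) * a := by ring
          _ ≤ N * a := by rw [hsq]; exact mul_le_mul_of_nonneg_right hNl ha0.le
      have : (countIn S P₂ : ℝ) ≤ k := by nlinarith
      exact_mod_cast this
    obtain ⟨m, rfl⟩ := Nat.exists_eq_add_of_le hkge
    have hset : {P₁ : {j // s j} → Ω | countIn S P₁ + countIn S P₂ = countIn S P₂ + m} =
        {P₁ | countIn S P₁ = m} := by
      ext P₁
      simp only [Set.mem_ofPred_eq]
      omega
    have hμT : (fun j : {j // s j} => μ j) = fun _ => w := funext fun j => hT j j.2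
    rw [hset, hμT, prodProb_const_countIn_eq hw1, hwS]
    refine le_trans ?_ (hbin N hNN₀ m ?_)
    · exact div_le_div_of_nonneg_left hc.le (Real.sqrt_pos.mpr hNpos) (Real.sqrt_le_sqrt hNn)
    · have h3 : (2 + C) * √n ≤ C' * √(N : ℝ) := by
        calc (2 + C) * √n = (2 + C) / √l * (√l * √n) := by field_simp
          _ ≤ (2 + C) / √l * √(N : ℝ) := mul_le_mul_of_nonneg_left hsqrtN (by positivity)
          _ ≤ C' * √(N : ℝ) := mul_le_mul_of_nonneg_right (by linarith) (by positivity)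
      push_cast at hk
      rw [abs_le]
      constructor <;> nlinarith
  calc 3 / 4 * c / √n = 3 / 4 * (c / √n) := by ring
    _ ≤ prodProb μ₂ badᶜ * (c / √n) := mul_le_mul_of_nonneg_right hgood (by positivity)
    _ ≤ _ := by
      unfold prodProb
      rw [Finset.sum_mul]
      refine Finset.sum_le_sum fun P₂ _ => ?_
      have hw : 0 ≤ ∏ j, μ₂ j (P₂ j) := Finset.prod_nonneg fun j _ => h0 j (P₂ j)
      by_cases hP₂ : P₂ ∈ badᶜ
      · rw [Set.indicator_of_mem hP₂]
        exact mul_le_mul_of_nonneg_left (hstep P₂ hP₂) hw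
      · rw [Set.indicator_of_notMem hP₂, zero_mul]
        exact mul_nonneg hw (prodProb_nonneg (μ := fun j : {j // s j} => μ j) (fun j => h0 j) _)

end LocalBound

section Allocation

/-- Finitely many weights can be approximated, up to a bounded error, by the frequencies of a
map from `Fin n`. -/
lemma exists_allocation {κ : Type*} [Fintype κ] [DecidableEq κ] {w : κ → ℝ}
    (h0 : ∀ t, 0 ≤ w t) (h1 : ∑ t, w t = 1) (t₀ : κ) (n : ℕ) :
    ∃ τ : Fin n → κ,
      (∀ t, |((Finset.univ.filter (fun j => τ j = t)).card : ℝ) - w t * n| ≤ Fintype.card κ) ∧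
      w t₀ * n ≤ (Finset.univ.filter (fun j => τ j = t₀)).card := by
  set fl : κ → ℕ := fun t => ⌊w t * n⌋₊ with hfl
  have hle : ∀ t, (fl t : ℝ) ≤ w t * n := fun t => Nat.floor_le (mul_nonneg (h0 t) n.cast_nonneg)
  have hlt : ∀ t, w t * n < fl t + 1 := fun t => Nat.lt_floor_add_one _
  have hwn : ∑ t, w t * n = n := by rw [← Finset.sum_mul, h1, one_mul]
  have hsum : (∑ t, fl t : ℕ) ≤ n := by
    have : ((∑ t, fl t : ℕ) : ℝ) ≤ n := by
      push_cast
      rw [← hwn]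
      exact Finset.sum_le_sum fun t _ => hle t
    exact_mod_cast this
  have hslack : (n : ℝ) - (∑ t, fl t : ℕ) ≤ Fintype.card κ := by
    have : (n : ℝ) ≤ ∑ t, ((fl t : ℝ) + 1) := by
      rw [← hwn]
      exact Finset.sum_le_sum fun t _ => (hlt t).le
    rw [Finset.sum_add_distrib] at this
    push_cast
    simp only [Finset.sum_const, Finset.card_univ, nsmul_eq_mul, mul_one] at this
    linarith
  set slack := n - ∑ t, fl t with hslackdef
  have hcast : (slack : ℝ) = n - (∑ t, fl t : ℕ) := Nat.cast_sub hsum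
  set m : κ → ℕ := fun t => fl t + if t = t₀ then slack else 0 with hm
  have hmsum : ∑ t, m t = n := by
    rw [hm, Finset.sum_add_distrib, Finset.sum_ite_eq']
    simp only [Finset.mem_univ, if_true]
    omega
  have hcardeq : Fintype.card (Fin n) = Fintype.card (Σ t, Fin (m t)) := by
    simp [hmsum]
  let e := Fintype.equivOfCardEq hcardeq
  have hfib : ∀ t, (Finset.univ.filter (fun j => (e j).1 = t)).card = m t := by
    intro t
    rw [← Fintype.card_subtype, ← Fintype.card_fin (m t)]
    exact Fintype.card_congr ((e.subtypeEquiv fun _ => Iff.rfl).trans (Equiv.sigmaSubtype t))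
  have hκ : (1 : ℝ) ≤ Fintype.card κ := by
    exact_mod_cast Fintype.card_pos_iff.mpr ⟨t₀⟩
  refine ⟨fun j => (e j).1, fun t => ?_, ?_⟩
  · rw [hfib t, hm]
    have a := hle t
    have b := hlt t
    dsimp only
    rw [abs_le]
    split_ifs
    · push_cast
      rw [hcast]
      have : (0 : ℝ) ≤ slack := Nat.cast_nonneg _
      constructor <;> linarith
    · push_cast
      constructor <;> linarith
  · rw [hfib t₀, hm]
    simp only [if_true]
    push_cast
    rw [hcast]
    have h2 : w t₀ * n - fl t₀ ≤ ∑ t, (w t * n - fl t) :=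
      Finset.single_le_sum (f := fun t => w t * n - fl t)
        (fun t _ => sub_nonneg.mpr (hle t)) (Finset.mem_univ t₀)
    rw [Finset.sum_sub_distrib, hwn] at h2
    push_cast
    linarith

lemma abs_sum_allocation_sub_le {κ : Type*} [Fintype κ] [DecidableEq κ] {w : κ → ℝ} {n : ℕ}
    {τ : Fin n → κ} {K : ℝ}
    (hτ : ∀ t, |((Finset.univ.filter (fun j => τ j = t)).card : ℝ) - w t * n| ≤ K)
    {g : κ → ℝ} (hg0 : ∀ t, 0 ≤ g t) (hg1 : ∀ t, g t ≤ 1) :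
    |∑ j, g (τ j) - n * ∑ t, w t * g t| ≤ Fintype.card κ * K := by
  have h : ∑ j, g (τ j) - n * ∑ t, w t * g t =
      ∑ t, (((Finset.univ.filter (fun j => τ j = t)).card : ℝ) - w t * n) * g t := by
    rw [← Finset.sum_fiberwise Finset.univ τ (fun j => g (τ j)), Finset.mul_sum,
      ← Finset.sum_sub_distrib]
    refine Finset.sum_congr rfl fun t _ => ?_
    rw [Finset.sum_congr rfl (g := fun _ => g t), Finset.sum_const, nsmul_eq_mul]
    · ring
    · intro j hj
      rw [(Finset.mem_filter.mp hj).2]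
  rw [h]
  refine (Finset.abs_sum_le_sum_abs _ _).trans ?_
  have h2 : ∀ t ∈ (Finset.univ : Finset κ),
      |(((Finset.univ.filter (fun j => τ j = t)).card : ℝ) - w t * n) * g t| ≤ K := by
    intro t _
    rw [abs_mul, abs_of_nonneg (hg0 t)]
    have := hτ t
    have := hg1 t
    have := hg0 t
    have := abs_nonneg (((Finset.univ.filter (fun j => τ j = t)).card : ℝ) - w t * n)
    nlinarith
  simpa using Finset.sum_le_sum h2

end Allocation

section QuotaRule

/-- The value of a single threshold test with margin `y` and tie-breaking `b`. -/
def threshold (b : Bool) (y : ℝ) : Bool :=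
  if 0 < y then true else if y = 0 then b else false

lemma threshold_eq_of_sgn_mul_pos {a b : Bool} {y : ℝ} (h : 0 < sgn a * y) :
    threshold b y = a := by
  unfold threshold
  cases a
  · have hy : y < 0 := by simpa [sgn] using h
    simp [hy.ne, hy.le]
  · have hy : 0 < y := by simpa [sgn] using h
    simp [hy]

lemma sgn_threshold_mul {b : Bool} {y : ℝ} (hy : y ≠ 0) : sgn (threshold b y) * y = |y| := by
  unfold threshold
  rcases lt_or_gt_of_ne hy with h | h
  · simp [hy, not_lt.mpr h.le, sgn, abs_of_neg h]
  · simp [h, sgn, abs_of_pos h]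

lemma threshold_sgn_mul (b b' e : Bool) {y : ℝ} (hy : y ≠ 0) :
    threshold b (sgn e * y) = (threshold b' y == e) := by
  rcases lt_or_gt_of_ne hy with h | h <;> cases e <;>
    simp [threshold, sgn, hy, h, not_lt.mpr h.le]

variable {p : ℕ} {f : Judg p → Bool} {q : Fin (p + 1) → ℝ} {d : Fin (p + 1) → Bool}
  {D : Set (Judg p → ℝ)}

lemma nOnes_eq_countIn {n : ℕ} (P : Fin n → Judg p) (i : Fin (p + 1)) :
    nOnes p n f P i = countIn (Omega p f i) P := by
  unfold nOnes Hist countIn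
  exact Finset.sum_card_fiberwise_eq_card_filter _ _ _

lemma quota_eq_threshold {n : ℕ} (P : Fin n → Judg p) (i : Fin (p + 1)) :
    quota p n f q d P i = threshold (d i) (countIn (Omega p f i) P - q i * n) := by
  unfold quota threshold
  rw [nOnes_eq_countIn]
  simp only [gt_iff_lt, sub_pos, sub_eq_zero]

lemma quotaDist_eq_threshold (π : Judg p → ℝ) (i : Fin (p + 1)) :
    quotaDist p f q d π i = threshold (d i) (pr p f π i - q i) := by
  unfold quotaDist threshold
  simp only [gt_iff_lt, sub_pos, sub_eq_zero]

lemma probParadox_eq_prodProb {n : ℕ} (v : Fin n → Judg p → ℝ) :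
    probParadox p n f q d v = prodProb v {P | Paradox p n f q d P} := by
  classical
  unfold probParadox prodProb
  refine Finset.sum_congr rfl fun P _ => ?_
  rw [Set.indicator_apply]
  rfl

lemma prodProb_le_DPmax (hdist : ∀ π ∈ D, IsDistribution p π) {n : ℕ}
    {v : Fin n → Judg p → ℝ} (hv : ∀ j, v j ∈ D) {A : Set (Fin n → Judg p)}
    (hA : ∀ P ∈ A, Paradox p n f q d P) : prodProb v A ≤ DPmax p n f q d D := by
  refine (prodProb_mono (B := {P | Paradox p n f q d P}) (fun j => (hdist _ (hv j)).1)
    fun P hP => hA P hP).trans ?_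
  rw [← probParadox_eq_prodProb]
  refine le_csSup ⟨1, ?_⟩ ⟨v, hv, rfl⟩
  rintro _ ⟨u, hu, rfl⟩
  rw [probParadox_eq_prodProb]
  exact prodProb_le_one (fun j => (hdist _ (hu j)).1) (fun j => (hdist _ (hu j)).2) _

lemma mem_Omega_castSucc (i : Fin p) (ω : Judg p) :
    ω ∈ Omega p f i.castSucc ↔ ω i = true := by
  simp [Omega]

lemma mem_Omega_last (ω : Judg p) : ω ∈ Omega p f (Fin.last p) ↔ f ω = true := by
  simp [Omega]

lemma cvec_castSucc (i : Fin p) (ω : Judg p) :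
    cvec p f q i.castSucc ω = q i.castSucc - bval (ω i) := by
  unfold cvec bval
  simp only [mem_Omega_castSucc]
  split_ifs <;> simp

lemma cvec_last (ω : Judg p) : cvec p f q (Fin.last p) ω = q (Fin.last p) - bval (f ω) := by
  unfold cvec bval
  simp only [mem_Omega_last]
  split_ifs <;> simp

lemma inn_cvec (i : Fin (p + 1)) (x : Judg p → ℝ) :
    inn p (cvec p f q i) x = q i * ∑ ω, x ω - ∑ ω ∈ Omega p f i, x ω := by
  have h : ∀ ω, cvec p f q i ω * x ω = q i * x ω - if ω ∈ Omega p f i then x ω else 0 := by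
    intro ω
    unfold cvec
    split_ifs <;> ring
  unfold inn
  simp_rw [h]
  rw [Finset.sum_sub_distrib, ← Finset.mul_sum, Finset.sum_ite_mem, Finset.univ_inter]

lemma sum_HistR {n : ℕ} (P : Fin n → Judg p) (S : Finset (Judg p)) :
    ∑ ω ∈ S, HistR p n P ω = countIn S P := by
  unfold HistR Hist countIn
  exact_mod_cast Finset.sum_card_fiberwise_eq_card_filter _ _ _

lemma inn_cvec_HistR {n : ℕ} (P : Fin n → Judg p) (i : Fin (p + 1)) :
    inn p (cvec p f q i) (HistR p n P) = -((countIn (Omega p f i) P : ℝ) - q i * n) := by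
  rw [inn_cvec, sum_HistR, sum_HistR]
  simp [countIn]

lemma bval_injective : Function.Injective bval := by
  intro a b h
  cases a <;> cases b <;> simp_all [bval]

lemma bval_eq_zero_or_one (b : Bool) : bval b = 0 ∨ bval b = 1 := by
  cases b <;> simp [bval]

/-- If the logical connection is an affine function of the premises, vanishing relations between
the vectors `cvec` force it to be constant or to depend on exactly one premise. -/
lemma const_or_kappa4_of_affine (β : Fin p → ℝ)
    (hβ : ∀ ω : Judg p, bval (f ω) - q (Fin.last p) = ∑ i, (bval (ω i) - q i.castSucc) * β i) :
    (∃ b, (∀ ω, f ω = b) ∧ q (Fin.last p) = bval b) ∨ kappa4 p f q := by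
  have hflip : ∀ (ω : Judg p) (i : Fin p),
      bval (f (Function.update ω i true)) - bval (f (Function.update ω i false)) = β i := by
    intro ω i
    have h1 := hβ (Function.update ω i true)
    have h0 := hβ (Function.update ω i false)
    have h2 : ∑ k, (bval (Function.update ω i true k) - q k.castSucc) * β k -
        ∑ k, (bval (Function.update ω i false k) - q k.castSucc) * β k = β i := by
      rw [← Finset.sum_sub_distrib, Finset.sum_eq_single i]
      · simp [bval]
        ring
      · intro k _ hk
        simp [Function.update_of_ne hk]
      · simp
    linarith
  by_cases hz : ∀ i, β i = 0
  · left
    have hω : ∀ ω, bval (f ω) = q (Fin.last p) := by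
      intro ω
      have := hβ ω
      simp only [hz, mul_zero, Finset.sum_const_zero] at this
      linarith
    exact ⟨f fun _ => false, fun ω => bval_injective ((hω ω).trans (hω _).symm), (hω _).symm⟩
  · right
    push Not at hz
    obtain ⟨i, hi⟩ := hz
    have hother : ∀ j, j ≠ i → β j = 0 := by
      intro j hji
      by_contra hj
      let ω : Judg p := fun _ => false
      have a1 := hflip (Function.update ω j true) i
      have a0 := hflip (Function.update ω j false) i
      have b1 := hflip (Function.update ω i true) j
      have b0 := hflip (Function.update ω i false) j
      rw [Function.update_comm hji.symm, Function.update_comm hji.symm] at b1 b0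
      rcases bval_eq_zero_or_one (f (Function.update (Function.update ω j true) i true))
        with h11 | h11 <;>
      rcases bval_eq_zero_or_one (f (Function.update (Function.update ω j true) i false))
        with h10 | h10 <;>
      rcases bval_eq_zero_or_one (f (Function.update (Function.update ω j false) i true))
        with h01 | h01 <;>
      rcases bval_eq_zero_or_one (f (Function.update (Function.update ω j false) i false))
        with h00 | h00 <;>
      rw [h11, h10] at a1 <;> rw [h01, h00] at a0 <;> rw [h11, h01] at b1 <;>
      rw [h10, h00] at b0 <;>
      first
        | exact hi (by linarith)
        | exact hj (by linarith)
    have hsingle : ∀ ω : Judg p,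
        bval (f ω) - q (Fin.last p) = (bval (ω i) - q i.castSucc) * β i := by
      intro ω
      rw [hβ ω, Finset.sum_eq_single i]
      · intro j _ hj
        rw [hother j hj, mul_zero]
      · simp
    have ht := hsingle fun _ => true
    have hf := hsingle fun _ => false
    simp only [bval, if_true, Bool.false_eq_true, if_false] at ht hf
    have hunit : β i = 1 ∨ β i = -1 := by
      have := hflip (fun _ => false) i
      rcases bval_eq_zero_or_one (f (Function.update (fun _ => false) i true)) with h1 | h1 <;>
      rcases bval_eq_zero_or_one (f (Function.update (fun _ => false) i false)) with h0 | h0 <;>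
      rw [h1, h0] at this
      · exact absurd (by linarith) hi
      · right; linarith
      · left; linarith
      · exact absurd (by linarith) hi
    refine ⟨i, ?_⟩
    rcases hunit with h | h
    · left
      rw [h] at ht hf
      have hq : q (Fin.last p) = q i.castSucc := by
        split_ifs at ht hf <;> linarith
      refine ⟨fun ω => bval_injective ?_, hq⟩
      have := hsingle ω
      rw [h] at this
      linarith
    · right
      rw [h] at ht hf
      have hq : q (Fin.last p) = 1 - q i.castSucc := by
        split_ifs at ht hf <;> linarith
      refine ⟨fun ω => bval_injective ?_, hq⟩
      have := hsingle ω
      rw [h] at this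
      have h2 : bval (!(ω i)) = 1 - bval (ω i) := by cases ω i <;> simp [bval]
      rw [h2]
      linarith

/-- Either the vectors `cvec` are linearly independent, so that all combinations of margins can
be realized, or the logical connection is degenerate. -/
lemma exists_inn_eq_or_degenerate (p : ℕ) (f : Judg p → Bool) (q : Fin (p + 1) → ℝ) :
    (∀ β : Fin (p + 1) → ℝ, ∃ v : Judg p → ℝ, ∀ i, inn p (cvec p f q i) v = β i) ∨
      (∃ b, (∀ ω, f ω = b) ∧ q (Fin.last p) = bval b) ∨ kappa4 p f q := by
  set L := Matrix.mulVecLin (Matrix.of (cvec p f q)) with hL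
  by_cases hsurj : Function.Surjective L
  · left
    intro β
    obtain ⟨v, hv⟩ := hsurj β
    exact ⟨v, fun i => congrFun hv i⟩
  right
  rw [← LinearMap.range_eq_top] at hsurj
  obtain ⟨φ, hφ, hle⟩ := Submodule.exists_le_ker_of_lt_top _ (lt_top_iff_ne_top.mpr hsurj)
  set a : Fin (p + 1) → ℝ := fun i => φ (Pi.single i 1) with ha
  have hφa : ∀ x, φ x = ∑ i, x i * a i := by
    intro x
    rw [LinearMap.pi_apply_eq_sum_univ φ x]
    refine Finset.sum_congr rfl fun i _ => ?_
    rw [smul_eq_mul, ha]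
    congr 2
    ext j
    simp [Pi.single_apply, eq_comm]
  have hrel : ∀ ω : Judg p, ∑ i : Fin p, (q i.castSucc - bval (ω i)) * a i.castSucc +
      (q (Fin.last p) - bval (f ω)) * a (Fin.last p) = 0 := by
    intro ω
    have h1 : φ (L (Pi.single ω 1)) = 0 := hle ⟨_, rfl⟩
    rw [hφa, Fin.sum_univ_castSucc] at h1
    simpa [hL, cvec_castSucc, cvec_last] using h1
  have hlast : a (Fin.last p) ≠ 0 := by
    intro h0
    apply hφ
    have hz : ∀ i : Fin p, a i.castSucc = 0 := by
      intro i
      have h1 := hrel (Function.update (fun _ => false) i true)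
      have h2 := hrel fun _ => false
      rw [h0, mul_zero, add_zero] at h1 h2
      have h3 := sub_eq_zero.mpr (h2.trans h1.symm)
      rw [← Finset.sum_sub_distrib, Finset.sum_eq_single i] at h3
      · simp only [Function.update_self, bval, if_true, Bool.false_eq_true, if_false] at h3
        linarith
      · intro j _ hj
        simp [Function.update_of_ne hj]
      · simp
    ext1 i
    have : a i = 0 := Fin.lastCases h0 hz i
    ext
    simpa [ha] using this
  refine const_or_kappa4_of_affine (fun i => -a i.castSucc / a (Fin.last p)) fun ω => ?_
  have h := hrel ω
  have h2 : ∑ i : Fin p, (bval (ω i) - q i.castSucc) * (-a i.castSucc / a (Fin.last p)) =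
      (∑ i : Fin p, (q i.castSucc - bval (ω i)) * a i.castSucc) / a (Fin.last p) := by
    rw [Finset.sum_div]
    refine Finset.sum_congr rfl fun i _ => ?_
    ring
  rw [h2, eq_div_iff hlast]
  linarith

end QuotaRule

section LowerBound

variable {p : ℕ} {f : Judg p → Bool} {q : Fin (p + 1) → ℝ} {d : Fin (p + 1) → Bool}
  {D : Set (Judg p → ℝ)}

lemma sum_eq_one_of_mem_convexHull (hdist : ∀ π ∈ D, IsDistribution p π) {π : Judg p → ℝ}
    (hπ : π ∈ convexHull ℝ D) : ∑ ω, π ω = 1 := by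
  have h : convexHull ℝ D ⊆ {x | ∑ ω, x ω = 1} := by
    refine convexHull_min (fun x hx => (hdist x hx).2) ?_
    intro x hx y hy a b _ _ hab
    rw [Set.mem_ofPred_eq] at hx hy ⊢
    simp only [Pi.add_apply, Pi.smul_apply, smul_eq_mul, Finset.sum_add_distrib,
      ← Finset.mul_sum, hx, hy, mul_one, hab]
  exact h hπ

/-- A point of the convex hull is approximated, up to bounded error in all counts, by the average
of `n` members of the set, a positive fraction of which coincide. -/
lemma exists_profile_of_mem_convexHull (hdist : ∀ π ∈ D, IsDistribution p π) {π : Judg p → ℝ}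
    (hπ : π ∈ convexHull ℝ D) :
    ∃ K : ℝ, 0 ≤ K ∧ ∃ w ∈ D, ∃ l : ℝ, 0 < l ∧ ∀ n : ℕ, ∃ v : Fin n → Judg p → ℝ,
      (∀ j, v j ∈ D) ∧
      (∀ S : Finset (Judg p), |∑ j, ∑ ω ∈ S, v j ω - n * ∑ ω ∈ S, π ω| ≤ K) ∧
      ∃ (s : Fin n → Prop) (_ : DecidablePred s), (∀ j, s j → v j = w) ∧
        l * n ≤ Fintype.card {j // s j} := by
  classical
  obtain ⟨κ, _, w, z, hw0, hw1, hz, hsum⟩ := mem_convexHull_iff_exists_fintype.mp hπ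
  obtain ⟨t₀, ht₀⟩ : ∃ t, 0 < w t := by
    by_contra! h
    have := Finset.sum_nonpos fun t (_ : t ∈ Finset.univ) => h t
    linarith
  refine ⟨Fintype.card κ * Fintype.card κ, by positivity, z t₀, hz t₀, w t₀, ht₀, fun n => ?_⟩
  obtain ⟨τ, hτ, hτ₀⟩ := exists_allocation hw0 hw1 t₀ n
  refine ⟨fun j => z (τ j), fun j => hz _, fun S => ?_, fun j => τ j = t₀, inferInstance,
    fun j hj => congrArg z hj, by rwa [Fintype.card_subtype]⟩
  have hπS : ∑ ω ∈ S, π ω = ∑ t, w t * ∑ ω ∈ S, z t ω := by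
    rw [← hsum]
    simp only [Finset.sum_apply, Pi.smul_apply, smul_eq_mul, Finset.mul_sum]
    exact Finset.sum_comm
  rw [hπS]
  refine abs_sum_allocation_sub_le (g := fun t => ∑ ω ∈ S, z t ω) hτ
    (fun t => Finset.sum_nonneg fun ω _ => (hdist _ (hz t)).1 ω) fun t => ?_
  rw [← (hdist _ (hz t)).2]
  exact Finset.sum_le_sum_of_subset_of_nonneg (Finset.subset_univ _)
    fun ω _ _ => (hdist _ (hz t)).1 ω

/-- Upgrade a lower bound for large `n` to all `n`, using strict positivity for small `n`. -/
lemma exists_lower_bound_of_eventually (hne : D.Nonempty) (hsp : StrictlyPositive p D)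
    (hdist : ∀ π ∈ D, IsDistribution p π) (R : ℕ → Prop) {c : ℝ} (hc : 0 < c) {N : ℕ}
    (h : ∀ n, N ≤ n → 1 ≤ n → ¬ kappa1 p n f q d → R n → c / √n ≤ DPmax p n f q d D) :
    ∃ c > (0 : ℝ), ∀ n : ℕ, 1 ≤ n → ¬ kappa1 p n f q d → R n →
      c / √n ≤ DPmax p n f q d D := by
  obtain ⟨ε, hε, hpos⟩ := hsp
  obtain ⟨w, hw⟩ := hne
  have hm0 : 0 < min ε 1 := lt_min hε one_pos
  refine ⟨min c (min ε 1 ^ N), lt_min hc (pow_pos hm0 N), fun n hn hk hR => ?_⟩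
  rcases le_or_gt N n with hNn | hNn
  · exact (div_le_div_of_nonneg_right (min_le_left _ _) (Real.sqrt_nonneg _)).trans
      (h n hNn hn hk hR)
  · unfold kappa1 at hk
    push Not at hk
    obtain ⟨P, hP⟩ := hk
    have hle : prodProb (fun _ : Fin n => w) {P} ≤ DPmax p n f q d D :=
      prodProb_le_DPmax hdist (fun _ => hw) fun Q hQ => by
        rw [Set.mem_singleton_iff.mp hQ]
        exact hP
    have hs : prodProb (fun _ : Fin n => w) {P} = ∏ j, w (P j) := by
      unfold prodProb
      rw [Finset.sum_eq_single P]
      · simp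
      · intro Q _ hQ
        simp [hQ]
      · simp
    have h1 : (1 : ℝ) ≤ √n := by
      rw [Real.one_le_sqrt]
      exact_mod_cast hn
    calc min c (min ε 1 ^ N) / √n ≤ min c (min ε 1 ^ N) :=
          div_le_self (lt_min hc (pow_pos hm0 N)).le h1
      _ ≤ min ε 1 ^ N := min_le_right _ _
      _ ≤ min ε 1 ^ n := pow_le_pow_of_le_one hm0.le (min_le_right _ _) hNn.le
      _ = ∏ _j : Fin n, min ε 1 := by simp
      _ ≤ ∏ j, w (P j) := Finset.prod_le_prod (fun _ _ => hm0.le)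
          fun j _ => (min_le_left _ _).trans (hpos w hw _)
      _ ≤ DPmax p n f q d D := hs ▸ hle

/-- When the connection is constant and its threshold is extremal, one paradox makes every
profile a paradox. -/
lemma one_le_DPmax_of_const (hne : D.Nonempty) (hdist : ∀ π ∈ D, IsDistribution p π) {b : Bool}
    (hf : ∀ ω, f ω = b) (hb : q (Fin.last p) = bval b) {n : ℕ} (hk : ¬ kappa1 p n f q d) :
    1 ≤ DPmax p n f q d D := by
  obtain ⟨w, hw⟩ := hne
  have hlast : ∀ P : Fin n → Judg p, quota p n f q d P (Fin.last p) = d (Fin.last p) := by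
    intro P
    have h0 : (countIn (Omega p f (Fin.last p)) P : ℝ) - q (Fin.last p) * n = 0 := by
      unfold countIn
      simp only [mem_Omega_last, hf, hb]
      cases b <;> simp [bval]
    rw [quota_eq_threshold, h0]
    simp [threshold]
  have hall : ∀ P : Fin n → Judg p, Paradox p n f q d P := by
    intro P
    unfold kappa1 Paradox Consistent at hk
    unfold Paradox Consistent
    simp only [hlast, hf] at hk ⊢
    push Not at hk
    exact hk.choose_spec
  rw [← prodProb_univ (μ := fun _ : Fin n => w) fun _ => (hdist w hw).2]
  exact prodProb_le_DPmax hdist (fun _ => hw) fun P _ => hall P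

lemma exists_inn_last_eq (h : kappa4 p f q) :
    ∃ (i : Fin p) (e : Bool), (∀ ω, f ω = (ω i == e)) ∧
      ∀ x, inn p (cvec p f q (Fin.last p)) x = sgn e * inn p (cvec p f q i.castSucc) x := by
  obtain ⟨i, ⟨hf, hq⟩ | ⟨hf, hq⟩⟩ := h
  · refine ⟨i, true, fun ω => by simp [hf], fun x => ?_⟩
    unfold inn
    rw [Finset.mul_sum]
    refine Finset.sum_congr rfl fun ω _ => ?_
    rw [cvec_last, cvec_castSucc, hf, hq]
    simp [sgn]
  · refine ⟨i, false, fun ω => by simp [hf], fun x => ?_⟩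
    unfold inn
    rw [Finset.mul_sum]
    refine Finset.sum_congr rfl fun ω _ => ?_
    rw [cvec_last, cvec_castSucc, hf, hq]
    cases ω i <;> simp [sgn, bval]
    ring

lemma exists_lower_bound_of_kappa4 (hne : D.Nonempty) (hsp : StrictlyPositive p D)
    (hdist : ∀ π ∈ D, IsDistribution p π) (h4 : kappa4 p f q) :
    ∃ c > (0 : ℝ), ∀ n : ℕ, 1 ≤ n → ¬ kappa1 p n f q d → ¬ kappa2 p n f q d D →
      c / √n ≤ DPmax p n f q d D := by
  obtain ⟨i, e, hf, hinn⟩ := exists_inn_last_eq h4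
  have hprof : ∀ (n : ℕ) (P : Fin n → Judg p),
      (countIn (Omega p f (Fin.last p)) P : ℝ) - q (Fin.last p) * n =
        sgn e * (countIn (Omega p f i.castSucc) P - q i.castSucc * n) := by
    intro n P
    have := hinn (HistR p n P)
    rw [inn_cvec_HistR, inn_cvec_HistR] at this
    linarith
  have hpar : ∀ (n : ℕ) (P : Fin n → Judg p), Paradox p n f q d P ↔
      (countIn (Omega p f i.castSucc) P : ℝ) = q i.castSucc * n ∧
        d (Fin.last p) ≠ (d i.castSucc == e) := by
    intro n P
    unfold Paradox Consistent
    rw [hf, quota_eq_threshold, quota_eq_threshold, hprof]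
    by_cases hy : (countIn (Omega p f i.castSucc) P : ℝ) - q i.castSucc * n = 0
    · rw [hy]
      simp [threshold, sub_eq_zero.mp hy]
    · rw [threshold_sgn_mul _ (d i.castSucc) e hy]
      simp [sub_ne_zero.mp hy]
  by_cases htie : ∃ π ∈ convexHull ℝ D, pr p f π i.castSucc = q i.castSucc
  · obtain ⟨π, hπ, hpr⟩ := htie
    obtain ⟨K, hK, w, hw, l, hl, hv⟩ := exists_profile_of_mem_convexHull hdist hπ
    obtain ⟨ε, hε, hpos⟩ := hsp
    have hΩ : ∑ ω, w ω = ∑ ω ∈ Omega p f i.castSucc, w ω +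
        ∑ ω ∈ (Omega p f i.castSucc)ᶜ, w ω := (Finset.sum_add_sum_compl _ _).symm
    rw [(hdist w hw).2] at hΩ
    have h1 : 0 < ∑ ω ∈ Omega p f i.castSucc, w ω :=
      Finset.sum_pos (fun ω _ => hε.trans_le (hpos w hw ω))
        ⟨fun _ => true, (mem_Omega_castSucc i _).mpr rfl⟩
    have h2 : 0 < ∑ ω ∈ (Omega p f i.castSucc)ᶜ, w ω :=
      Finset.sum_pos (fun ω _ => hε.trans_le (hpos w hw ω))
        ⟨fun _ => false, by simp [mem_Omega_castSucc]⟩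
    obtain ⟨c, hc, N, hN⟩ := exists_prodProb_countIn_eq_lower_bound (Omega p f i.castSucc) h1
      (by linarith) hl hK (hdist w hw).2 rfl
    obtain ⟨c', hc', h⟩ := exists_lower_bound_of_eventually hne ⟨ε, hε, hpos⟩ hdist
      (f := f) (q := q) (d := d) (fun _ => True) hc (N := N) fun n hn _ hk _ => by
        unfold kappa1 at hk
        push Not at hk
        obtain ⟨P, hP⟩ := hk
        obtain ⟨hPc, hd⟩ := (hpar n P).mp hP
        obtain ⟨v, hvD, hvK, s, _, hs, hcard⟩ := hv n
        refine (hN n hn v (fun j ω => (hdist _ (hvD j)).1 ω) (fun j => (hdist _ (hvD j)).2) s hs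
          hcard (countIn (Omega p f i.castSucc) P) ?_).trans
          (prodProb_le_DPmax hdist hvD fun Q hQ => (hpar n Q).mpr ⟨?_, hd⟩)
        · rw [hPc, ← hpr, mul_comm]
          exact hvK _
        · rw [Set.mem_ofPred_eq] at hQ
          rw [hQ, hPc]
    exact ⟨c', hc', fun n hn hk _ => h n hn hk trivial⟩
  · push Not at htie
    refine ⟨1, one_pos, fun n _ _ hk2 => absurd ?_ hk2⟩
    rintro π hπ α ⟨hα, -⟩
    have hm : pr p f π (Fin.last p) - q (Fin.last p) =
        sgn e * (pr p f π i.castSucc - q i.castSucc) := by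
      have := hinn π
      rw [inn_cvec, inn_cvec, sum_eq_one_of_mem_convexHull hdist hπ] at this
      unfold pr
      linarith
    have hi := sub_ne_zero.mpr (htie π hπ)
    have hl : pr p f π (Fin.last p) - q (Fin.last p) ≠ 0 := by
      rw [hm]
      exact mul_ne_zero (by cases e <;> simp [sgn]) hi
    unfold Consistent
    rw [hf, hα _ (sub_ne_zero.mp hl), hα _ (sub_ne_zero.mp hi), quotaDist_eq_threshold,
      quotaDist_eq_threshold, hm, threshold_sgn_mul _ _ _ hi]

lemma neg_abs_le_sgn_mul (b : Bool) (y : ℝ) : -|y| ≤ sgn b * y := by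
  cases b
  · simpa [sgn] using le_abs_self y
  · simpa [sgn] using neg_abs_le y

lemma sgn_mul_self (b : Bool) : sgn b * sgn b = 1 := by
  cases b <;> simp [sgn]

/-- If margins can be moved independently, every refinement of a distribution in the convex hull
is the outcome with probability bounded below. -/
lemma exists_lower_bound_of_refines (hsp : StrictlyPositive p D)
    (hdist : ∀ π ∈ D, IsDistribution p π)
    (hsurj : ∀ β : Fin (p + 1) → ℝ, ∃ v : Judg p → ℝ, ∀ i, inn p (cvec p f q i) v = β i)
    {π : Judg p → ℝ} (hπ : π ∈ convexHull ℝ D) {α : Fin (p + 1) → Bool}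
    (hα : Refines p f q d π α) :
    ∃ c > (0 : ℝ), ∃ N : ℕ, ∀ n, N ≤ n → ∃ v : Fin n → Judg p → ℝ, (∀ j, v j ∈ D) ∧
      c ≤ prodProb v {P | quota p n f q d P = α} := by
  obtain ⟨ε, hε, hpos⟩ := hsp
  obtain ⟨K, hK, _, _, _, _, hprofile⟩ := exists_profile_of_mem_convexHull hdist hπ
  have hπ1 := sum_eq_one_of_mem_convexHull hdist hπ
  obtain ⟨v₀, hv₀⟩ := hsurj fun i => -sgn (α i)
  set T : ℝ := 2 * (p + 1) with hT
  have hT0 : 0 < T := by positivity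
  set v : Judg p → ℝ := fun ω => (T + 1) * (v₀ ω - (∑ η, v₀ η) * π ω) with hv
  have hvsum : ∑ ω, v ω = 0 := by
    simp only [hv, ← Finset.mul_sum, Finset.sum_sub_distrib, hπ1]
    ring
  have hvΩ : ∀ i, ∑ ω ∈ Omega p f i, v ω =
      (T + 1) * (sgn (α i) - (∑ η, v₀ η) * (pr p f π i - q i)) := by
    intro i
    have := hv₀ i
    rw [inn_cvec] at this
    simp only [hv, ← Finset.mul_sum, Finset.sum_sub_distrib]
    unfold pr
    linear_combination -(T + 1) * this
  have hlarge : ∀ᶠ r : ℝ in Filter.atTop, ∀ i, T * r + K <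
      sgn (α i) * (r ^ 2 * (pr p f π i - q i) + r * ∑ ω ∈ Omega p f i, v ω) := by
    rw [Filter.eventually_all]
    intro i
    by_cases hi : pr p f π i = q i
    · filter_upwards [Filter.eventually_gt_atTop K] with r hr
      rw [hvΩ, hi]
      linear_combination hr - r * (T + 1) * sgn_mul_self (α i)
    · have hδ : 0 < |pr p f π i - q i| := abs_pos.mpr (sub_ne_zero.mpr hi)
      have hsgn : sgn (α i) * (pr p f π i - q i) = |pr p f π i - q i| := by
        rw [hα i hi, quotaDist_eq_threshold, sgn_threshold_mul (sub_ne_zero.mpr hi)]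
      set b := sgn (α i) * ∑ ω ∈ Omega p f i, v ω with hb
      filter_upwards [Filter.eventually_ge_atTop 1,
        Filter.eventually_ge_atTop ((|b - T| + K + 1) / |pr p f π i - q i|)] with r hr1 hr
      rw [div_le_iff₀ hδ] at hr
      have h1 : r * (|b - T| + K + 1) ≤ r * (r * |pr p f π i - q i|) :=
        mul_le_mul_of_nonneg_left hr (by linarith)
      have h2 : r * -|b - T| ≤ r * (b - T) :=
        mul_le_mul_of_nonneg_left (neg_abs_le _) (by linarith)
      have h3 : K ≤ r * K := le_mul_of_one_le_left hK hr1
      have h4 : sgn (α i) * (r ^ 2 * (pr p f π i - q i) + r * ∑ ω ∈ Omega p f i, v ω) =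
          r * (r * |pr p f π i - q i|) + r * b := by
        rw [← hsgn, hb]
        ring
      rw [h4]
      linarith
  have hevent : ∀ᶠ n : ℕ in Filter.atTop, 0 < √(n : ℝ) ∧ (∑ ω, |v ω|) / ε ≤ √(n : ℝ) ∧
      ∀ i, T * √(n : ℝ) + K < sgn (α i) *
        (√(n : ℝ) ^ 2 * (pr p f π i - q i) + √(n : ℝ) * ∑ ω ∈ Omega p f i, v ω) :=
    (Real.tendsto_sqrt_atTop.comp tendsto_natCast_atTop_atTop).eventually
      ((Filter.eventually_gt_atTop 0).and ((Filter.eventually_ge_atTop _).and hlarge))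
  obtain ⟨N, hN⟩ := Filter.eventually_atTop.mp hevent
  refine ⟨1 / 4 / Real.exp ((∑ ω, v ω ^ 2) / ε), by positivity, N, fun n hn => ?_⟩
  obtain ⟨hr0, hrε, hr⟩ := hN n hn
  obtain ⟨u, huD, huK, -⟩ := hprofile n
  refine ⟨u, huD, ?_⟩
  set r := √(n : ℝ) with hrdef
  have hrn : r ^ 2 = n := Real.sq_sqrt n.cast_nonneg
  set ν : Fin n → Judg p → ℝ := fun j ω => u j ω + r⁻¹ * v ω with hν
  have hν0 : ∀ j ω, 0 ≤ ν j ω := by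
    intro j ω
    have h1 := hpos _ (huD j) ω
    have h2 : |v ω| ≤ ∑ η, |v η| :=
      Finset.single_le_sum (f := fun η => |v η|) (fun η _ => abs_nonneg _) (Finset.mem_univ ω)
    rw [div_le_iff₀ hε] at hrε
    have h3 : r⁻¹ * -(r * ε) ≤ r⁻¹ * v ω :=
      mul_le_mul_of_nonneg_left (by linarith [neg_abs_le (v ω)]) (inv_pos.mpr hr0).le
    have h4 : r⁻¹ * -(r * ε) = -ε := by field_simp
    simp only [hν]
    linarith
  have hν1 : ∀ j, ∑ ω, ν j ω = 1 := by
    intro j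
    simp only [hν, Finset.sum_add_distrib, ← Finset.mul_sum, hvsum, (hdist _ (huD j)).2]
    ring
  have hmean : ∀ S : Finset (Judg p),
      ∑ j, ∑ ω ∈ S, ν j ω = ∑ j, ∑ ω ∈ S, u j ω + r * ∑ ω ∈ S, v ω := by
    intro S
    simp only [hν, Finset.sum_add_distrib, ← Finset.mul_sum]
    rw [Finset.sum_const, Finset.card_univ, Fintype.card_fin, nsmul_eq_mul, ← hrn]
    field_simp
  have hunion := one_le_prodProb_add_sum hν0 hν1 {P | quota p n f q d P = α}
    (fun i => {P | T * r ≤ |(countIn (Omega p f i) P : ℝ) - ∑ j, ∑ ω ∈ Omega p f i, ν j ω|})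
    (by
      intro P hP
      rw [Set.mem_ofPred_eq]
      funext i
      have hPi := hP i
      rw [Set.mem_ofPred_eq, not_le, hmean] at hPi
      have hKi := huK (Omega p f i)
      have hri := hr i
      rw [quota_eq_threshold]
      apply threshold_eq_of_sgn_mul_pos
      have h1 := neg_abs_le_sgn_mul (α i) ((countIn (Omega p f i) P : ℝ) -
        (∑ j, ∑ ω ∈ Omega p f i, u j ω + r * ∑ ω ∈ Omega p f i, v ω))
      have h2 := neg_abs_le_sgn_mul (α i) (∑ j, ∑ ω ∈ Omega p f i, u j ω -
        n * ∑ ω ∈ Omega p f i, π ω)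
      have h3 : sgn (α i) * (countIn (Omega p f i) P - q i * n) =
          sgn (α i) * ((countIn (Omega p f i) P : ℝ) -
            (∑ j, ∑ ω ∈ Omega p f i, u j ω + r * ∑ ω ∈ Omega p f i, v ω)) +
          sgn (α i) * (∑ j, ∑ ω ∈ Omega p f i, u j ω - n * ∑ ω ∈ Omega p f i, π ω) +
          sgn (α i) * (r ^ 2 * (pr p f π i - q i) + r * ∑ ω ∈ Omega p f i, v ω) := by
        rw [hrn]
        unfold pr
        ring
      rw [h3]
      linarith)
  have hcheb : ∑ i, prodProb ν
      {P | T * r ≤ |(countIn (Omega p f i) P : ℝ) - ∑ j, ∑ ω ∈ Omega p f i, ν j ω|} ≤ 1 / 2 := by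
    calc _ ≤ ∑ _i : Fin (p + 1), (Fintype.card (Fin n) : ℝ) / (T * r) ^ 2 :=
          Finset.sum_le_sum fun i _ =>
            prodProb_countIn_le hν0 hν1 (Omega p f i) (mul_pos hT0 hr0)
      _ = 1 / (2 * T) := by
          rw [Finset.sum_const, Finset.card_univ, Fintype.card_fin, Fintype.card_fin,
            nsmul_eq_mul, ← hrn, hT]
          push_cast
          field_simp
      _ ≤ 1 / 2 := by
          apply one_div_le_one_div_of_le two_pos
          have : (0 : ℝ) ≤ p := p.cast_nonneg
          linarith
  have hsq := sq_prodProb_le_of_perturb (s := r⁻¹) hε (fun j ω => hpos _ (huD j) ω)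
    (fun j => (hdist _ (huD j)).2) (fun j ω => rfl) hvsum
    (by rw [Fintype.card_fin, ← hrn, inv_pow, inv_mul_cancel₀ (pow_pos hr0 2).ne'])
    {P | quota p n f q d P = α}
  rw [div_le_iff₀ (Real.exp_pos _)]
  refine le_trans ?_ hsq
  have hhalf : 1 / 2 ≤ prodProb ν {P | quota p n f q d P = α} := by linarith
  calc (1 / 4 : ℝ) = (1 / 2) ^ 2 := by norm_num
    _ ≤ prodProb ν {P | quota p n f q d P = α} ^ 2 := pow_le_pow_left₀ (by norm_num) hhalf 2

lemma exists_lower_bound_of_surjective (hne : D.Nonempty) (hsp : StrictlyPositive p D)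
    (hdist : ∀ π ∈ D, IsDistribution p π)
    (hsurj : ∀ β : Fin (p + 1) → ℝ, ∃ v : Judg p → ℝ, ∀ i, inn p (cvec p f q i) v = β i) :
    ∃ c > (0 : ℝ), ∀ n : ℕ, 1 ≤ n → ¬ kappa1 p n f q d → ¬ kappa2 p n f q d D →
      c / √n ≤ DPmax p n f q d D := by
  have hα : ∀ α : Fin (p + 1) → Bool, ∃ c > (0 : ℝ), ∀ n : ℕ, 1 ≤ n → ¬ kappa1 p n f q d →
      (¬ Consistent p f α ∧ ∃ π ∈ convexHull ℝ D, Refines p f q d π α) →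
      c / √n ≤ DPmax p n f q d D := by
    intro α
    by_cases h : ¬ Consistent p f α ∧ ∃ π ∈ convexHull ℝ D, Refines p f q d π α
    · obtain ⟨hcons, π, hπ, href⟩ := h
      obtain ⟨c, hc, N, hN⟩ := exists_lower_bound_of_refines hsp hdist hsurj hπ href
      refine exists_lower_bound_of_eventually hne hsp hdist (fun _ => _) hc (N := N)
        fun n hn hn1 _ _ => ?_
      obtain ⟨v, hvD, hv⟩ := hN n hn
      refine (div_le_self hc.le ?_).trans (hv.trans (prodProb_le_DPmax hdist hvD ?_))
      · rw [Real.one_le_sqrt]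
        exact_mod_cast hn1
      · intro P hP
        rw [Set.mem_ofPred_eq] at hP
        unfold Paradox
        rwa [hP]
    · exact ⟨1, one_pos, fun n _ _ h' => absurd h' h⟩
  choose c hc hbound using hα
  obtain ⟨α₀, hmin⟩ := Finite.exists_min c
  refine ⟨c α₀, hc α₀, fun n hn h1 h2 => ?_⟩
  unfold kappa2 at h2
  push Not at h2
  obtain ⟨π, hπ, α, hα, hcons⟩ := h2
  exact (div_le_div_of_nonneg_right (hmin α) (Real.sqrt_nonneg _)).trans
    (hbound α n hn h1 ⟨hcons, π, hπ, hα.1⟩)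

end LowerBound

/-- there is `c > 0` such that whenever κ1(n) and κ2(n) both fail,
`DP^max(n) ≥ c·n^{−1/2}`. -/
theorem stmt_14 (p : ℕ) (hp : 1 ≤ p) (f : Judg p → Bool)
    (q : Fin (p + 1) → ℝ) (hq : ∀ i, q i ∈ Set.Icc (0 : ℝ) 1)
    (d : Fin (p + 1) → Bool) (D : Set (Judg p → ℝ)) (hne : D.Nonempty)
    (hcl : IsClosed D) (hsp : StrictlyPositive p D)
    (hdist : ∀ π ∈ D, IsDistribution p π) :
    ∃ c > (0 : ℝ), ∀ n : ℕ, 1 ≤ n → ¬ kappa1 p n f q d → ¬ kappa2 p n f q d D →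
      c * (n : ℝ) ^ (-(1 : ℝ) / 2) ≤ DPmax p n f q d D := by
  have h : ∃ c > (0 : ℝ), ∀ n : ℕ, 1 ≤ n → ¬ kappa1 p n f q d → ¬ kappa2 p n f q d D →
      c / √n ≤ DPmax p n f q d D := by
    rcases exists_inn_eq_or_degenerate p f q with hsurj | ⟨b, hf, hb⟩ | h4
    · exact exists_lower_bound_of_surjective hne hsp hdist hsurj
    · refine ⟨1, one_pos, fun n hn hk _ => le_trans ?_ (one_le_DPmax_of_const hne hdist hf hb hk)⟩
      apply div_le_self zero_le_one
      rw [Real.one_le_sqrt]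
      exact_mod_cast hn
    · exact exists_lower_bound_of_kappa4 hne hsp hdist h4
  obtain ⟨c, hc, hbound⟩ := h
  refine ⟨c, hc, fun n hn h1 h2 => ?_⟩
  have hpow : (n : ℝ) ^ (-(1 : ℝ) / 2) = (√n)⁻¹ := by
    rw [neg_div, Real.rpow_neg n.cast_nonneg, Real.sqrt_eq_rpow]
  rw [hpow, ← div_eq_mul_inv]
  exact hbound n hn h1 h2

end
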